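/- arXiv:2605.18620 — 2 statements merged into one kernel-verified Lean document; each statement's English description precedes it below -/
import Mathlib

section
/- Define Ψ(u) := Φ(√2·Φ⁻¹(u)) for u ∈ (0,1), and set S_n := n ∫₀¹ (1−u)^{n−1} [ 1 − (1 − Ψ(u))^{n−1} ] du. Then lim_{n→∞} (n/√(log n)) · S_n = 2√(2π). -/
open Filter Set

/-- The standard normal cumulative distribution function
`Φ(t) = ∫_{-∞}^t e^{-z²/2}/√(2π) dz`. -/
noncomputable def stdNormalCDF (t : ℝ) : ℝ :=
  ∫ z in Set.Iic t, Real.exp (-z ^ 2 / 2) / Real.sqrt (2 * Real.pi)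

/-- The inverse function `Φ⁻¹ : (0,1) → ℝ` of the standard normal CDF. -/
noncomputable def stdNormalCDFInv : ℝ → ℝ :=
  Function.invFun stdNormalCDF

/-- The GOE off-diagonal tail-transfer function `Ψ(u) = Φ(√2·Φ⁻¹(u))`. -/
noncomputable def PsiGOE (u : ℝ) : ℝ :=
  stdNormalCDF (Real.sqrt 2 * stdNormalCDFInv u)

open MeasureTheory ProbabilityTheory Topology

noncomputable def phiN (t : ℝ) : ℝ := Real.exp (-t ^ 2 / 2) / Real.sqrt (2 * Real.pi)

lemma phiN_eq : phiN = gaussianPDFReal 0 1 := by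
  funext t
  simp [phiN, gaussianPDFReal, div_eq_inv_mul]

lemma phiN_pos (t : ℝ) : 0 < phiN t := by unfold phiN; positivity

lemma phiN_cont : Continuous phiN := by unfold phiN; fun_prop

lemma phiN_integrable : Integrable phiN := by
  rw [phiN_eq]; exact integrable_gaussianPDFReal 0 1

lemma Phi_eq (t : ℝ) : stdNormalCDF t = ∫ z in Set.Iic t, phiN z := rfl

lemma Phi_eq_cdf : stdNormalCDF = cdf (gaussianReal 0 1) := by
  funext t
  rw [cdf_eq_real, Measure.real, gaussianReal_apply_eq_integral 0 one_ne_zero, Phi_eq, phiN_eq,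
    ENNReal.toReal_ofReal]
  exact integral_nonneg (fun x => gaussianPDFReal_nonneg 0 1 x)

lemma Phi_hasDeriv (t : ℝ) : HasDerivAt stdNormalCDF (phiN t) t := by
  have h : stdNormalCDF = fun s => stdNormalCDF 0 + ∫ z in (0:ℝ)..s, phiN z := by
    funext s
    rw [← intervalIntegral.integral_Iic_sub_Iic phiN_integrable.integrableOn
      phiN_integrable.integrableOn, Phi_eq, Phi_eq]
    ring
  rw [h]
  exact (intervalIntegral.integral_hasDerivAt_right phiN_integrable.intervalIntegrable
    phiN_cont.stronglyMeasurable.stronglyMeasurableAtFilter phiN_cont.continuousAt).const_add _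

lemma Phi_strictMono : StrictMono stdNormalCDF :=
  strictMono_of_hasDerivAt_pos Phi_hasDeriv (fun x => phiN_pos x)

lemma Phi_cont : Continuous stdNormalCDF :=
  continuous_iff_continuousAt.2 fun t => (Phi_hasDeriv t).continuousAt

lemma Phi_atBot : Tendsto stdNormalCDF atBot (𝓝 0) := by
  rw [Phi_eq_cdf]; exact tendsto_cdf_atBot _

lemma Phi_atTop : Tendsto stdNormalCDF atTop (𝓝 1) := by
  rw [Phi_eq_cdf]; exact tendsto_cdf_atTop _

lemma Phi_nonneg (t : ℝ) : 0 ≤ stdNormalCDF t := by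
  rw [Phi_eq_cdf]; exact cdf_nonneg _ _

lemma Phi_le_one (t : ℝ) : stdNormalCDF t ≤ 1 := by
  rw [Phi_eq_cdf]; exact cdf_le_one _ _

lemma Phi_pos (t : ℝ) : 0 < stdNormalCDF t :=
  (Phi_nonneg (t-1)).trans_lt (Phi_strictMono (by linarith))

lemma Phi_lt_one (t : ℝ) : stdNormalCDF t < 1 :=
  (Phi_strictMono (by linarith : t < t+1)).trans_le (Phi_le_one (t+1))

lemma Phi_inv {u : ℝ} (hu : u ∈ Ioo (0:ℝ) 1) : stdNormalCDF (stdNormalCDFInv u) = u := by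
  apply Function.invFun_eq
  apply mem_range_of_exists_le_of_exists_ge Phi_cont
  · exact ((Phi_atBot.eventually_lt_const hu.1).exists).imp fun _ h => h.le
  · exact ((Phi_atTop.eventually_const_lt hu.2).exists).imp fun _ h => h.le

lemma Phi_inv_atBot : Tendsto stdNormalCDFInv (𝓝[>] 0) atBot := by
  rw [tendsto_atBot]
  intro K
  have h1 : ∀ᶠ u in 𝓝[>] (0:ℝ), u ∈ Ioo (0:ℝ) (stdNormalCDF K) := Ioo_mem_nhdsGT (Phi_pos K)
  filter_upwards [h1] with u hu
  have := Phi_inv ⟨hu.1, hu.2.trans (Phi_lt_one K)⟩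
  rw [← Phi_strictMono.le_iff_le, this]
  exact hu.2.le

lemma Psi_nonneg (u : ℝ) : 0 ≤ PsiGOE u := Phi_nonneg _
lemma Psi_le_one (u : ℝ) : PsiGOE u ≤ 1 := Phi_le_one _

lemma Psi_mono : MonotoneOn PsiGOE (Ioo 0 1) := by
  intro u hu v hv huv
  apply Phi_strictMono.monotone
  apply mul_le_mul_of_nonneg_left _ (Real.sqrt_nonneg 2)
  rw [← Phi_strictMono.le_iff_le, Phi_inv hu, Phi_inv hv]
  exact huv

lemma Psi_meas : ∃ G : ℝ → ℝ, Measurable G ∧ ∀ u ∈ Ioo (0:ℝ) 1, G u = PsiGOE u := by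
  refine ⟨fun u => if u ≤ 0 then 0 else if u < 1 then PsiGOE u else 1, Monotone.measurable ?_, ?_⟩
  · intro u v huv
    have := Psi_nonneg u
    have := Psi_nonneg v
    have := Psi_le_one u
    have := Psi_le_one v
    by_cases h : u ∈ Ioo (0:ℝ) 1 ∧ v ∈ Ioo (0:ℝ) 1
    · have := Psi_mono h.1 h.2 huv
      simp only [h.1.1.not_ge, h.2.1.not_ge, h.1.2, h.2.2, if_true, if_false]
      exact this
    · simp only [mem_Ioo, not_and_or, not_lt] at h
      dsimp only
      split_ifs <;> first | linarith | (exfalso; grind)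
  · intro u hu
    simp [hu.1.not_ge, hu.2]

/-- Mills ratio -/
lemma mills : Tendsto (fun t => stdNormalCDF t / (phiN t / (-t))) atBot (𝓝 1) := by
  have hphi' : ∀ t, HasDerivAt phiN (-t * phiN t) t := by
    intro t
    unfold phiN
    have h1 : HasDerivAt (fun t : ℝ => -t^2/2) (-t) t := by
      refine ((hasDerivAt_pow 2 t).neg.div_const 2).congr_deriv ?_
      simp only [Nat.cast_ofNat]
      ring
    refine (h1.exp.div_const (Real.sqrt (2*Real.pi))).congr_deriv ?_
    ring
  have hb : Tendsto (fun t : ℝ => -t) atBot atTop := tendsto_neg_atBot_atTop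
  refine HasDerivAt.lhopital_zero_atBot (f' := phiN) (g' := fun t => phiN t * (1 + 1/t^2))
    (Eventually.of_forall Phi_hasDeriv) ?_ ?_ Phi_atBot ?_ ?_
  · filter_upwards [eventually_lt_atBot 0] with t ht
    refine ((hphi' t).div (hasDerivAt_id t).neg (by simpa using ht.ne)).congr_deriv ?_
    have h0 := ht.ne
    simp only [id, Pi.neg_apply]
    field_simp
    ring
  · filter_upwards with t
    have := phiN_pos t
    positivity
  · have h0 : Tendsto (fun t : ℝ => (1 / Real.sqrt (2*Real.pi)) * (-t)⁻¹) atBot (𝓝 0) := by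
      simpa using (tendsto_inv_atTop_zero.comp hb).const_mul (1 / Real.sqrt (2*Real.pi))
    refine squeeze_zero' ?_ ?_ h0
    · filter_upwards [eventually_lt_atBot 0] with t ht
      have := phiN_pos t
      have : 0 < -t := by linarith
      positivity
    · filter_upwards [eventually_lt_atBot 0] with t ht
      have : 0 < -t := by linarith
      rw [div_eq_mul_inv]
      gcongr
      unfold phiN
      gcongr
      rw [Real.exp_le_one_iff]
      nlinarith [sq_nonneg t]
  · have h2 : Tendsto (fun t : ℝ => 1 + ((-t)⁻¹)^2) atBot (𝓝 1) := by
      simpa using ((tendsto_inv_atTop_zero.comp hb).pow 2).const_add 1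
    have h3 := h2.inv₀ one_ne_zero
    rw [inv_one] at h3
    refine h3.congr fun t => ?_
    have := phiN_pos t
    have : 0 < 1 + 1/t^2 := by positivity
    rw [div_mul_cancel_left₀ (phiN_pos t).ne']
    simp

lemma logPhi : Tendsto (fun t => -Real.log (stdNormalCDF t) / t^2) atBot (𝓝 (1/2)) := by
  have hb : Tendsto (fun t : ℝ => -t) atBot atTop := tendsto_neg_atBot_atTop
  have hi : Tendsto (fun t : ℝ => (-t)⁻¹) atBot (𝓝 0) := tendsto_inv_atTop_zero.comp hb
  have hl : Tendsto (fun t : ℝ => Real.log (-t) / (-t)) atBot (𝓝 0) :=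
    (Real.isLittleO_log_id_atTop.tendsto_div_nhds_zero).comp hb
  have hm : Tendsto (fun t => Real.log (stdNormalCDF t / (phiN t / (-t)))) atBot (𝓝 0) := by
    simpa using (mills.log one_ne_zero)
  have key : Tendsto (fun t => 1/2 + Real.log (-t) / (-t) * (-t)⁻¹ +
      (Real.log (Real.sqrt (2*Real.pi)) - Real.log (stdNormalCDF t / (phiN t / (-t)))) * ((-t)⁻¹)^2)
      atBot (𝓝 (1/2 + 0 * 0 + (Real.log (Real.sqrt (2*Real.pi)) - 0) * 0^2)) :=
    ((hl.mul hi).const_add _).add ((hm.const_sub _).mul (hi.pow 2))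
  have e : (1/2 + 0 * 0 + (Real.log (Real.sqrt (2*Real.pi)) - 0) * 0^2 : ℝ) = 1/2 := by ring
  rw [e] at key
  refine key.congr' ?_
  filter_upwards [eventually_lt_atBot 0] with t ht
  have ht' : 0 < -t := by linarith
  have hp := phiN_pos t
  rw [Real.log_div (Phi_pos t).ne' (by positivity), Real.log_div hp.ne' ht'.ne']
  have : Real.log (phiN t) = -t^2/2 - Real.log (Real.sqrt (2*Real.pi)) := by
    unfold phiN
    rw [Real.log_div (Real.exp_ne_zero _) (by positivity), Real.log_exp]
  rw [this]
  have h0 := ht.ne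
  field_simp
  ring

lemma ratioPhi : Tendsto (fun t => stdNormalCDF (Real.sqrt 2 * t) /
    (stdNormalCDF t ^ 2 * Real.sqrt (-Real.log (stdNormalCDF t)))) atBot
    (𝓝 (Real.sqrt (2 * Real.pi))) := by
  have h2 : (0:ℝ) < Real.sqrt 2 := by positivity
  have m1 : Tendsto (fun t => stdNormalCDF (Real.sqrt 2 * t) /
      (phiN (Real.sqrt 2 * t) / (-(Real.sqrt 2 * t)))) atBot (𝓝 1) :=
    mills.comp (tendsto_id.const_mul_atBot h2)
  have m2 := mills.pow 2
  have m3 := (logPhi.sqrt)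
  have key := ((m1.div m2 (by simp)).mul_const (Real.sqrt (2*Real.pi) / Real.sqrt 2)).div m3
    (by positivity)
  have e : 1 / 1 ^ 2 * (Real.sqrt (2*Real.pi) / Real.sqrt 2) / Real.sqrt (1/2) =
      Real.sqrt (2*Real.pi) := by
    rw [Real.sqrt_div zero_le_one, Real.sqrt_one]
    field_simp
  rw [e] at key
  refine key.congr' ?_
  filter_upwards [eventually_lt_atBot 0] with t ht
  have hP := Phi_pos t
  have hl : 0 < -Real.log (stdNormalCDF t) := by
    have := Real.log_neg hP (Phi_lt_one t); linarith
  have hls : 0 < Real.sqrt (-Real.log (stdNormalCDF t)) := Real.sqrt_pos.2 hl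
  have hp2 : phiN (Real.sqrt 2 * t) = Real.sqrt (2*Real.pi) * phiN t ^ 2 := by
    unfold phiN
    have hs : 0 < Real.sqrt (2*Real.pi) := by positivity
    rw [div_pow, ← Real.exp_nat_mul, mul_pow, Real.sq_sqrt (by norm_num : (0:ℝ) ≤ 2)]
    field_simp
    congr 1
    push_cast
    ring
  have hp := phiN_pos t
  have hst : Real.sqrt (t^2) = -t := by rw [Real.sqrt_sq_eq_abs, abs_of_neg ht]
  simp only [Pi.div_apply]
  rw [Real.sqrt_div hl.le, hst, hp2]
  have hs : 0 < Real.sqrt (2*Real.pi) := by positivity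
  have ht0 := ht.ne
  generalize Real.sqrt (2*Real.pi) = a at *
  generalize Real.sqrt (-Real.log (stdNormalCDF t)) = b at *
  field_simp

lemma ratioPsi : Tendsto (fun u => PsiGOE u / (u^2 * Real.sqrt (-Real.log u))) (𝓝[>] 0)
    (𝓝 (Real.sqrt (2 * Real.pi))) := by
  refine (ratioPhi.comp Phi_inv_atBot).congr' ?_
  have h1 : ∀ᶠ u in 𝓝[>] (0:ℝ), u ∈ Ioo (0:ℝ) 1 := Ioo_mem_nhdsGT zero_lt_one
  filter_upwards [h1] with u hu
  simp only [Function.comp, Phi_inv hu]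
  rfl

lemma Psi_bound : ∃ C : ℝ, 0 ≤ C ∧ ∀ u ∈ Ioo (0:ℝ) 1,
    PsiGOE u ≤ C * (u^2 * Real.sqrt (1 - Real.log u)) := by
  set B := Real.sqrt (2*Real.pi) + 1
  have hB : 0 < B := by positivity
  have h := ratioPsi.eventually_lt_const (lt_add_one _ : Real.sqrt (2*Real.pi) < B)
  obtain ⟨d, hd, hd'⟩ := (mem_nhdsGT_iff_exists_Ioo_subset).1 h
  have hd : 0 < d := hd
  refine ⟨B + 1/d^2, by positivity, fun u hu => ?_⟩
  have hlog := Real.log_neg hu.1 hu.2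
  have hs1 : 1 ≤ Real.sqrt (1 - Real.log u) := by
    rw [Real.one_le_sqrt]; linarith
  have hu0 := hu.1
  by_cases hud : u < d
  · have h3 : PsiGOE u / (u^2 * Real.sqrt (-Real.log u)) < B := hd' ⟨hu.1, hud⟩
    have : 0 < Real.sqrt (-Real.log u) := Real.sqrt_pos.2 (by linarith)
    rw [div_lt_iff₀ (by positivity)] at h3
    refine h3.le.trans ?_
    gcongr
    · have : 0 < 1/d^2 := by positivity
      linarith
    · linarith
  · push Not at hud
    have h5 : 1 ≤ 1/d^2 * u^2 := by
      rw [div_mul_eq_mul_div, one_mul, one_le_div (by positivity)]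
      gcongr
    calc PsiGOE u ≤ 1 := Psi_le_one u
      _ ≤ 1/d^2 * u^2 := h5
      _ ≤ 1/d^2 * (u^2 * Real.sqrt (1 - Real.log u)) := by
        gcongr; exact le_mul_of_one_le_right (by positivity) hs1
      _ ≤ _ := by gcongr; linarith

lemma pow_upper {p : ℝ} (hp : p ≤ 1) (m : ℕ) : 1 - (1 - p)^m ≤ m * p := by
  have := one_add_mul_le_pow (a := -p) (by linarith) m
  have e : (1 + -p) = 1 - p := by ring
  rw [e] at this
  linarith

lemma pow_lower {p : ℝ} (hp0 : 0 ≤ p) (hp : p ≤ 1) (m : ℕ) :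
    m * p - (m * p)^2 ≤ 1 - (1 - p)^m := by
  have h1 : (1-p)^m ≤ Real.exp (-(m*p)) := by
    have : (1-p)^m ≤ (Real.exp (-p))^m := by
      exact pow_le_pow_left₀ (by linarith) (Real.one_sub_le_exp_neg p) m
    rw [← Real.exp_nat_mul] at this
    convert this using 2
    ring
  set y := (m:ℝ)*p with hy
  have hy0 : 0 ≤ y := by positivity
  have h2 : Real.exp (-y) ≤ 1 - y + y^2 := by
    rw [Real.exp_neg, inv_le_comm₀ (Real.exp_pos _) (by nlinarith [sq_nonneg (y-1)])]
    have h3 : 1 + y ≤ Real.exp y := by linarith [Real.add_one_le_exp y]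
    refine le_trans ?_ h3
    rw [inv_le_iff_one_le_mul₀ (by nlinarith [sq_nonneg (y-1)])]
    nlinarith [pow_nonneg hy0 3]
  linarith

noncomputable def FN (n : ℕ) (v : ℝ) : ℝ :=
  ((n : ℝ) / Real.sqrt (Real.log n)) * (Ioo (0:ℝ) 1).indicator
    (fun u => (1 - u) ^ (n - 1) * (1 - (1 - PsiGOE u) ^ (n - 1))) ((n:ℝ)⁻¹ * v)

lemma FN_integral (n : ℕ) (hn : 0 < n) : ((n : ℝ) / Real.sqrt (Real.log n)) *
          ((n : ℝ) * ∫ u in Set.Ioo (0 : ℝ) 1,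
            (1 - u) ^ (n - 1) * (1 - (1 - PsiGOE u) ^ (n - 1))) = ∫ v in Ioi (0:ℝ), FN n v := by
  unfold FN
  have hn' : (0:ℝ) < (n:ℝ)⁻¹ := by positivity
  rw [integral_const_mul, integral_comp_mul_left_Ioi _ _ hn', inv_inv, mul_zero,
    setIntegral_indicator measurableSet_Ioo, smul_eq_mul,
    inter_eq_self_of_subset_right Ioo_subset_Ioi_self]

lemma FN_meas (n : ℕ) : Measurable (FN n) := by
  obtain ⟨G, hG, hGP⟩ := Psi_meas
  have : FN n = fun v => ((n : ℝ) / Real.sqrt (Real.log n)) * (Ioo (0:ℝ) 1).indicator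
    (fun u => (1 - u) ^ (n - 1) * (1 - (1 - G u) ^ (n - 1))) ((n:ℝ)⁻¹ * v) := by
    funext v
    unfold FN
    congr 1
    by_cases h : (n:ℝ)⁻¹ * v ∈ Ioo (0:ℝ) 1
    · simp only [indicator_of_mem h, hGP _ h]
    · simp only [indicator_of_notMem h]
  rw [this]
  have h2 : Measurable ((Ioo (0:ℝ) 1).indicator
    (fun u => (1 - u) ^ (n - 1) * (1 - (1 - G u) ^ (n - 1)))) :=
    Measurable.indicator (by fun_prop) measurableSet_Ioo
  exact (h2.comp (measurable_const_mul _)).const_mul _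

lemma FN_bound : ∃ C : ℝ, 0 ≤ C ∧ ∀ n : ℕ, 3 ≤ n → ∀ v ∈ Ioi (0:ℝ),
    ‖FN n v‖ ≤ C * ((3 * v^2 + v) * Real.exp (-(1/2) * v)) := by
  obtain ⟨C, hC, hCb⟩ := Psi_bound
  refine ⟨C, hC, fun n hn v hv => ?_⟩
  have hv : 0 < v := hv
  have hn3 : (3:ℝ) ≤ n := by exact_mod_cast hn
  have hn0 : (0:ℝ) < n := by linarith
  unfold FN
  by_cases h : (n:ℝ)⁻¹ * v ∈ Ioo (0:ℝ) 1
  swap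
  · rw [indicator_of_notMem h, mul_zero, norm_zero]; positivity
  rw [indicator_of_mem h]
  set u := (n:ℝ)⁻¹ * v with hu
  have hnu : n * u = v := by rw [hu]; field_simp
  have hL1 : 1 ≤ Real.log n := by
    rw [Real.le_log_iff_exp_le hn0]
    linarith [Real.exp_one_lt_d9]
  have hsL : 1 ≤ Real.sqrt (Real.log n) := by rwa [Real.one_le_sqrt]
  have hP0 := Psi_nonneg u
  have hP1 := Psi_le_one u
  have hc : ((n-1 : ℕ) : ℝ) = n - 1 := by rw [Nat.cast_sub (by omega)]; simp
  have hq0 : 0 ≤ 1 - (1 - PsiGOE u)^(n-1) := by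
    have := pow_le_one₀ (n := n-1) (by linarith : 0 ≤ 1 - PsiGOE u) (by linarith)
    linarith
  have h1u : 0 ≤ 1 - u := by linarith [h.2]
  rw [Real.norm_of_nonneg (by positivity)]
  have hexp : (1-u)^(n-1) ≤ Real.exp (-(1/2)*v) := by
    calc (1-u)^(n-1) ≤ (Real.exp (-u))^(n-1) := by
          gcongr; exact Real.one_sub_le_exp_neg u
      _ = Real.exp (((n-1 : ℕ):ℝ) * (-u)) := by rw [Real.exp_nat_mul]
      _ ≤ _ := by
        rw [Real.exp_le_exp, hc, ← hnu]
        nlinarith [h.1]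
  have hq : 1 - (1 - PsiGOE u)^(n-1) ≤ n * (C * (u^2 * Real.sqrt (1 - Real.log u))) := by
    refine (pow_upper hP1 _).trans ?_
    have := hCb u h
    gcongr
    · omega
  have hsq : Real.sqrt (1 - Real.log u) ≤ (3 + 1/v) * Real.sqrt (Real.log n) := by
    have hlu : Real.log u = Real.log v - Real.log n := by
      rw [hu, Real.log_mul (by positivity) hv.ne', Real.log_inv]; ring
    have hlv : - Real.log v ≤ 1/v := by
      have := Real.log_le_sub_one_of_pos (inv_pos.2 hv)
      rw [Real.log_inv] at this
      rw [one_div]; linarith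
    have hv1 : 0 < 1/v := by positivity
    rw [Real.sqrt_le_left (by positivity), mul_pow, Real.sq_sqrt (by linarith), hlu]
    nlinarith [mul_nonneg hv1.le (by linarith : 0 ≤ Real.log n - 1), sq_nonneg (1/v),
      mul_nonneg (sq_nonneg (1/v)) (by linarith : 0 ≤ Real.log n)]
  calc (n:ℝ) / Real.sqrt (Real.log n) * ((1-u)^(n-1) * (1 - (1 - PsiGOE u)^(n-1)))
      ≤ (n:ℝ) / Real.sqrt (Real.log n) * (Real.exp (-(1/2)*v) *
        (n * (C * (u^2 * ((3 + 1/v) * Real.sqrt (Real.log n)))))) := by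
        gcongr
        exact hq.trans (by gcongr)
    _ = _ := by
      have : 0 < Real.sqrt (Real.log n) := by linarith
      rw [hu]
      field_simp

lemma FN_lim (v : ℝ) (hv : 0 < v) : Tendsto (fun n => FN n v) atTop
    (𝓝 (Real.sqrt (2*Real.pi) * (Real.exp (-v) * v^2))) := by
  have hcast : Tendsto (fun n : ℕ => (n:ℝ)) atTop atTop := tendsto_natCast_atTop_atTop
  have hinv : Tendsto (fun n : ℕ => (n:ℝ)⁻¹) atTop (𝓝 0) := tendsto_inv_atTop_zero.comp hcast
  have hlog : Tendsto (fun n : ℕ => Real.log n) atTop atTop := Real.tendsto_log_atTop.comp hcast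
  have hu0 : Tendsto (fun n : ℕ => (n:ℝ)⁻¹ * v) atTop (𝓝 0) := by simpa using hinv.mul_const v
  have hu : Tendsto (fun n : ℕ => (n:ℝ)⁻¹ * v) atTop (𝓝[>] 0) := by
    rw [tendsto_nhdsWithin_iff]
    refine ⟨hu0, ?_⟩
    filter_upwards [eventually_gt_atTop 0] with n hn
    have : (0:ℝ) < n := by exact_mod_cast hn
    exact mul_pos (inv_pos.2 this) hv
  -- the power factor
  have hE : Tendsto (fun n : ℕ => (1 - (n:ℝ)⁻¹ * v)^(n-1)) atTop (𝓝 (Real.exp (-v))) := by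
    have h1 := Real.tendsto_one_add_div_pow_exp (-v)
    have h2 : Tendsto (fun n : ℕ => 1 - (n:ℝ)⁻¹ * v) atTop (𝓝 1) := by
      simpa using hu0.const_sub 1
    have h3 := h1.div h2 one_ne_zero
    rw [div_one] at h3
    refine h3.congr' ?_
    filter_upwards [eventually_gt_atTop 0, h2.eventually_ne one_ne_zero] with n hn hne
    obtain ⟨m, rfl⟩ : ∃ m, n = m + 1 := ⟨n-1, by omega⟩
    have e : 1 + -v / ((m+1 : ℕ):ℝ) = 1 - ((m+1 : ℕ):ℝ)⁻¹ * v := by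
      rw [div_eq_mul_inv]; ring
    simp only [Pi.div_apply]
    rw [e, pow_succ, Nat.add_sub_cancel, mul_div_assoc, div_self hne, mul_one]
  -- the main factor
  have hmn : Tendsto (fun n : ℕ => ((n-1 : ℕ) : ℝ) * (n:ℝ)⁻¹) atTop (𝓝 1) := by
    have : Tendsto (fun n : ℕ => 1 - (n:ℝ)⁻¹) atTop (𝓝 1) := by simpa using hinv.const_sub 1
    refine this.congr' ?_
    filter_upwards [eventually_gt_atTop 0] with n hn
    have h0 : (0:ℝ) < n := by exact_mod_cast hn
    rw [Nat.cast_sub (by omega)]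
    field_simp
    simp
  have hls : Tendsto (fun n : ℕ => Real.sqrt (-Real.log ((n:ℝ)⁻¹ * v) / Real.log n)) atTop (𝓝 1) := by
    have h1 : Tendsto (fun n : ℕ => 1 - Real.log v * (Real.log n)⁻¹) atTop (𝓝 1) := by
      simpa using ((tendsto_inv_atTop_zero.comp hlog).const_mul (Real.log v)).const_sub 1
    have h2 := h1.sqrt
    rw [Real.sqrt_one] at h2
    refine h2.congr' ?_
    filter_upwards [eventually_gt_atTop 0, hlog.eventually_gt_atTop 0] with n hn hl
    have h0 : (0:ℝ) < n := by exact_mod_cast hn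
    congr 1
    rw [Real.log_mul (by positivity) hv.ne', Real.log_inv]
    field_simp
    ring
  have hA : Tendsto (fun n : ℕ => (n:ℝ) / Real.sqrt (Real.log n) *
      (((n-1 : ℕ) : ℝ) * PsiGOE ((n:ℝ)⁻¹ * v))) atTop (𝓝 (Real.sqrt (2*Real.pi) * v^2)) := by
    have key := (((ratioPsi.comp hu).mul hmn).mul hls).mul_const (v^2)
    rw [mul_one, mul_one] at key
    refine key.congr' ?_
    have hlt := hu.eventually (Ioo_mem_nhdsGT zero_lt_one : ∀ᶠ u in 𝓝[>] (0:ℝ), u ∈ Ioo (0:ℝ) 1)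
    filter_upwards [eventually_gt_atTop 0, hlog.eventually_gt_atTop 0, hlt] with n hn hl hun
    have h0 : (0:ℝ) < n := by exact_mod_cast hn
    have hlu : 0 < -Real.log ((n:ℝ)⁻¹ * v) := by linarith [Real.log_neg hun.1 hun.2]
    simp only [Function.comp]
    rw [Real.sqrt_div hlu.le]
    have s1 := Real.sqrt_pos.2 hlu
    have s2 := Real.sqrt_pos.2 hl
    generalize Real.sqrt (-Real.log ((n:ℝ)⁻¹ * v)) = a at *
    generalize Real.sqrt (Real.log n) = b at *
    generalize PsiGOE ((n:ℝ)⁻¹ * v) = p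
    field_simp
  have hB : Tendsto (fun n : ℕ => ((n-1 : ℕ) : ℝ) * PsiGOE ((n:ℝ)⁻¹ * v)) atTop (𝓝 0) := by
    have h1 : Tendsto (fun n : ℕ => Real.sqrt (Real.log n / n)) atTop (𝓝 0) := by
      have := ((Real.isLittleO_log_id_atTop.tendsto_div_nhds_zero).comp hcast).sqrt
      simpa using this
    have h2 : Tendsto (fun n : ℕ => Real.sqrt ((n:ℝ)⁻¹)) atTop (𝓝 0) := by
      simpa using hinv.sqrt
    have key := hA.mul (h1.mul h2)
    rw [mul_zero, mul_zero] at key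
    refine key.congr' ?_
    filter_upwards [eventually_gt_atTop 0, hlog.eventually_gt_atTop 0] with n hn hl
    have h0 : (0:ℝ) < n := by exact_mod_cast hn
    have s2 := Real.sqrt_pos.2 hl
    rw [Real.sqrt_div hl.le, Real.sqrt_inv]
    have hsn : Real.sqrt n * Real.sqrt n = n := Real.mul_self_sqrt h0.le
    have hsn0 := Real.sqrt_pos.2 h0
    calc _ = (n:ℝ) / (Real.sqrt n * Real.sqrt n) * (((n-1 : ℕ) : ℝ) * PsiGOE ((n:ℝ)⁻¹ * v)) := by
          field_simp
      _ = _ := by rw [hsn, div_self h0.ne', one_mul]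
  have hC : Tendsto (fun n : ℕ => (n:ℝ) / Real.sqrt (Real.log n) *
      (1 - (1 - PsiGOE ((n:ℝ)⁻¹ * v))^(n-1))) atTop (𝓝 (Real.sqrt (2*Real.pi) * v^2)) := by
    have hlow := hA.sub (hA.mul hB)
    rw [mul_zero, sub_zero] at hlow
    refine tendsto_of_tendsto_of_tendsto_of_le_of_le hlow hA ?_ ?_
    · intro n
      have := pow_lower (Psi_nonneg ((n:ℝ)⁻¹ * v)) (Psi_le_one _) (n-1)
      have h0 : 0 ≤ (n:ℝ) / Real.sqrt (Real.log n) := by positivity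
      have := mul_le_mul_of_nonneg_left this h0
      refine le_trans (le_of_eq ?_) this
      ring
    · intro n
      have := pow_upper (Psi_le_one ((n:ℝ)⁻¹ * v)) (n-1)
      have h0 : 0 ≤ (n:ℝ) / Real.sqrt (Real.log n) := by positivity
      exact mul_le_mul_of_nonneg_left this h0
  have fin := hE.mul hC
  have e : Real.sqrt (2*Real.pi) * (Real.exp (-v) * v^2) =
    Real.exp (-v) * (Real.sqrt (2*Real.pi) * v^2) := by ring
  rw [e]
  refine fin.congr' ?_
  have hlt := hu.eventually (Ioo_mem_nhdsGT zero_lt_one : ∀ᶠ u in 𝓝[>] (0:ℝ), u ∈ Ioo (0:ℝ) 1)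
  filter_upwards [hlt] with n hun
  unfold FN
  rw [indicator_of_mem (show (n:ℝ)⁻¹ * v ∈ Ioo (0:ℝ) 1 from hun)]
  ring

/-- Minimum-diagonal contribution: with
`S_n = n∫₀¹ (1−u)^{n−1}[1 − (1 − Ψ(u))^{n−1}] du`, one has
`(n/√(log n)) S_n → 2√(2π)`. -/
theorem minimum_diagonal_contribution_asymptotics :
    Tendsto (fun n : ℕ =>
        ((n : ℝ) / Real.sqrt (Real.log n)) *
          ((n : ℝ) * ∫ u in Set.Ioo (0 : ℝ) 1,
            (1 - u) ^ (n - 1) * (1 - (1 - PsiGOE u) ^ (n - 1))))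
      atTop (nhds (2 * Real.sqrt (2 * Real.pi))) := by
  obtain ⟨C, hC, hb⟩ := FN_bound
  have hlim : Tendsto (fun n => ∫ v in Ioi (0:ℝ), FN n v) atTop
      (𝓝 (∫ v in Ioi (0:ℝ), Real.sqrt (2*Real.pi) * (Real.exp (-v) * v^2))) := by
    refine tendsto_integral_filter_of_dominated_convergence
      (fun v => C * ((3 * v^2 + v) * Real.exp (-(1/2) * v))) ?_ ?_ ?_ ?_
    · exact Eventually.of_forall fun n => (FN_meas n).aestronglyMeasurable
    · filter_upwards [eventually_ge_atTop 3] with n hn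
      exact (ae_restrict_iff' measurableSet_Ioi).2 (Eventually.of_forall (hb n hn))
    · apply Integrable.const_mul
      have h2 := integrableOn_rpow_mul_exp_neg_mul_rpow (p := 1) (s := 2) (b := 1/2)
        (by norm_num) (by norm_num) (by norm_num)
      have h1 := integrableOn_rpow_mul_exp_neg_mul_rpow (p := 1) (s := 1) (b := 1/2)
        (by norm_num) (by norm_num) (by norm_num)
      have h3 := (h2.const_mul 3).add h1
      refine h3.congr (Eventually.of_forall fun v => ?_)
      simp
      ring
    · exact (ae_restrict_iff' measurableSet_Ioi).2 (Eventually.of_forall FN_lim)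
  have hval : ∫ v in Ioi (0:ℝ), Real.sqrt (2*Real.pi) * (Real.exp (-v) * v^2) =
      2 * Real.sqrt (2*Real.pi) := by
    rw [integral_const_mul]
    have h := Real.Gamma_eq_integral (s := 3) (by norm_num)
    have h3 : Real.Gamma 3 = 2 := by
      have := Real.Gamma_nat_eq_factorial 2
      have e2 : (3:ℝ) = ((2:ℕ):ℝ) + 1 := by norm_num
      rw [e2, this]
      norm_num [Nat.factorial]
    have e : (3:ℝ) - 1 = (2:ℕ) := by norm_num
    rw [h3, e] at h
    simp only [Real.rpow_natCast] at h
    rw [← h]; ring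
  rw [hval] at hlim
  refine hlim.congr' ?_
  filter_upwards [eventually_gt_atTop 0] with n hn
  exact (FN_integral n hn).symm
end

section
/- For 0 < u < v < 1 define p(u,v,w) := Φ( √2 [ Φ⁻¹(u) − √( (Φ⁻¹(v) − Φ⁻¹(u)) (Φ⁻¹(w) − Φ⁻¹(u)) ) ] ) for v < w < 1, and G(u,v) := (1/(1−v)) ∫_v^1 p(u,v,w) dw. For 0 < x < n let s_n(x) := -Φ⁻¹(x/n). Then for every 0 < δ < M < ∞ and B < ∞, as n → ∞, the supremum over (x,β) ∈ [δ,M]×[0,B] of | (n² / s_n(x)) · G( x/n , x(1+β/s_n(x)²)/n ) − √π · x² e^{−2√β} | tends to 0 (with the value at β = 0 understood by continuous extension from v > u). -/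
open Filter Set

/-- The pair probability
`p(u,v,w) = Φ(√2[Φ⁻¹(u) − √((Φ⁻¹(v)−Φ⁻¹(u))(Φ⁻¹(w)−Φ⁻¹(u)))])`. -/
noncomputable def pPair (u v w : ℝ) : ℝ :=
  stdNormalCDF (Real.sqrt 2 * (stdNormalCDFInv u -
    Real.sqrt ((stdNormalCDFInv v - stdNormalCDFInv u) *
      (stdNormalCDFInv w - stdNormalCDFInv u))))

/-- The averaged edge-probability function
`G(u,v) = (1/(1−v)) ∫_v^1 p(u,v,w) dw` (which at `v = u` coincides with the
continuous extension from `v > u`). -/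
noncomputable def Gavg (u v : ℝ) : ℝ :=
  (1 / (1 - v)) * ∫ w in Set.Ioo v 1, pPair u v w

/-- The lower-tail quantile scale `s_n(x) = -Φ⁻¹(x/n)`, defined for `0 < x < n`. -/
noncomputable def sQ (n : ℕ) (x : ℝ) : ℝ :=
  -stdNormalCDFInv (x / n)

namespace BL
open MeasureTheory Topology

/-- standard normal density -/
noncomputable def phi (z : ℝ) : ℝ := Real.exp (-z ^ 2 / 2) / Real.sqrt (2 * Real.pi)

lemma phi_pos (z : ℝ) : 0 < phi z := by unfold phi; positivity

lemma phi_cont : Continuous phi := by unfold phi; fun_prop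

lemma phi_eq : phi = fun z => Real.exp (-(1/2) * z ^ 2) / Real.sqrt (2 * Real.pi) := by
  funext z; unfold phi; congr 2; ring

lemma phi_int : Integrable phi := by
  rw [phi_eq]
  exact (integrable_exp_neg_mul_sq (by norm_num)).div_const _

lemma phi_total : ∫ z, phi z = 1 := by
  rw [phi_eq, integral_div, integral_gaussian]
  have : Real.pi / (1/2) = 2 * Real.pi := by ring
  rw [this]
  exact div_self (by positivity)

lemma Phi_sub (a b : ℝ) : stdNormalCDF b - stdNormalCDF a = ∫ z in a..b, phi z :=
  intervalIntegral.integral_Iic_sub_Iic phi_int.integrableOn phi_int.integrableOn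

lemma Phi_deriv (t : ℝ) : HasDerivAt stdNormalCDF (phi t) t := by
  have h : stdNormalCDF = fun t => stdNormalCDF 0 + ∫ z in (0:ℝ)..t, phi z := by
    funext t; rw [← Phi_sub]; ring
  rw [h]
  exact (intervalIntegral.integral_hasDerivAt_right phi_int.intervalIntegrable
    (phi_cont.stronglyMeasurableAtFilter _ _) phi_cont.continuousAt).const_add _

lemma Phi_cont : Continuous stdNormalCDF :=
  continuous_iff_continuousAt.2 fun t => (Phi_deriv t).continuousAt

lemma Phi_mono : StrictMono stdNormalCDF :=
  strictMono_of_deriv_pos fun t => by rw [(Phi_deriv t).deriv]; exact phi_pos t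

lemma Phi_top : Tendsto stdNormalCDF atTop (𝓝 1) := by
  rw [← phi_total]
  exact (aecover_Iic tendsto_id).integral_tendsto_of_countably_generated phi_int

lemma Phi_neg (t : ℝ) : stdNormalCDF (-t) = 1 - stdNormalCDF t := by
  have h1 : stdNormalCDF (-t) = ∫ z in Set.Ioi t, phi z := by
    have := integral_comp_neg_Iic (-t) phi
    rw [neg_neg] at this
    rw [← this]
    unfold stdNormalCDF phi
    simp
  have h2 : stdNormalCDF t + ∫ z in Set.Ioi t, phi z = 1 := by
    rw [← phi_total]
    exact intervalIntegral.integral_Iic_add_Ioi phi_int.integrableOn phi_int.integrableOn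
  linarith

lemma Phi_bot : Tendsto (fun t => stdNormalCDF (-t)) atTop (𝓝 0) := by
  simp_rw [Phi_neg]
  simpa using Phi_top.const_sub 1

lemma Phi_pos (t : ℝ) : 0 < stdNormalCDF t := by
  have h : 0 ≤ stdNormalCDF (t - 1) :=
    setIntegral_nonneg measurableSet_Iic fun z _ => (phi_pos z).le
  exact h.trans_lt (Phi_mono (by linarith))

lemma Phi_lt_one (t : ℝ) : stdNormalCDF t < 1 := by
  have := Phi_neg t
  have := Phi_pos (-t)
  linarith

lemma inv_Phi (t : ℝ) : stdNormalCDFInv (stdNormalCDF t) = t :=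
  Function.leftInverse_invFun Phi_mono.injective t

lemma Phi_surj {w : ℝ} (h0 : 0 < w) (h1 : w < 1) : ∃ z, stdNormalCDF z = w := by
  obtain ⟨a, ha⟩ := (Phi_bot.eventually (gt_mem_nhds h0)).exists
  obtain ⟨b, hb⟩ := (Phi_top.eventually (lt_mem_nhds h1)).exists
  exact mem_range_of_exists_le_of_exists_ge Phi_cont ⟨_, ha.le⟩ ⟨_, hb.le⟩

lemma Phi_inv {w : ℝ} (h0 : 0 < w) (h1 : w < 1) : stdNormalCDF (stdNormalCDFInv w) = w :=
  Function.invFun_eq (Phi_surj h0 h1)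

lemma phi_deriv (t : ℝ) : HasDerivAt phi (-t * phi t) t := by
  have h : HasDerivAt (fun z : ℝ => -z ^ 2 / 2) (-t) t := by
    have := ((hasDerivAt_pow 2 t).neg).div_const 2
    exact this.congr_deriv (by push_cast; ring)
  have := h.exp.div_const (Real.sqrt (2 * Real.pi))
  exact this.congr_deriv (by unfold phi; ring)

lemma phi_neg (t : ℝ) : phi (-t) = phi t := by unfold phi; simp

/-- Mills ratio factor -/
noncomputable def r (t : ℝ) : ℝ := t * stdNormalCDF (-t) / phi t

lemma phi_top : Tendsto phi atTop (𝓝 0) := by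
  have h : Tendsto (fun z : ℝ => -z ^ 2 / 2) atTop atBot := by
    have : Tendsto (fun z : ℝ => z ^ 2 / 2) atTop atTop :=
      (tendsto_pow_atTop (by norm_num)).atTop_div_const (by norm_num)
    have := tendsto_neg_atTop_atBot.comp this
    refine this.congr fun z => ?_
    simp; ring
  have := (Real.tendsto_exp_atBot.comp h).div_const (Real.sqrt (2 * Real.pi))
  rw [zero_div] at this
  exact this

lemma r_tendsto : Tendsto r atTop (𝓝 1) := by
  have key : Tendsto (fun t => stdNormalCDF (-t) / (phi t / t)) atTop (𝓝 1) := by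
    apply HasDerivAt.lhopital_zero_atTop (f' := fun t => - phi t)
      (g' := fun t => (-t * phi t * t - phi t * 1) / t ^ 2)
    · refine Eventually.of_forall fun t => ?_
      have := (Phi_deriv (-t)).comp t (hasDerivAt_neg t)
      exact this.congr_deriv (by rw [phi_neg]; ring)
    · filter_upwards [eventually_gt_atTop 0] with t ht
      exact (phi_deriv t).div (hasDerivAt_id t) ht.ne'
    · filter_upwards [eventually_gt_atTop 0] with t ht
      have := phi_pos t
      have h : -t * phi t * t - phi t * 1 < 0 := by nlinarith [mul_pos ht (mul_pos ht this)]
      exact (div_neg_of_neg_of_pos h (by positivity)).ne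
    · exact Phi_bot
    · simpa [div_eq_mul_inv] using phi_top.mul tendsto_inv_atTop_zero
    · have h1 : Tendsto (fun t : ℝ => 1 / (1 + t⁻¹ ^ 2)) atTop (𝓝 (1 / (1 + 0 ^ 2))) :=
        (tendsto_const_nhds).div (tendsto_const_nhds.add (tendsto_inv_atTop_zero.pow 2)) (by norm_num)
      have h2 : Tendsto (fun t : ℝ => 1 / (1 + t⁻¹ ^ 2)) atTop (𝓝 1) := by simpa using h1
      refine h2.congr' ?_
      filter_upwards [eventually_gt_atTop 0] with t ht
      have := phi_pos t
      have h3 : -t * phi t * t - phi t * 1 = - (phi t * (t ^ 2 + 1)) := by ring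
      rw [h3]
      field_simp
      try ring
  refine key.congr' ?_
  filter_upwards [eventually_gt_atTop 0] with t ht
  have := phi_pos t
  unfold r
  field_simp

lemma Phi_eq_r {t : ℝ} (ht : 0 < t) : stdNormalCDF (-t) = phi t / t * r t := by
  have := phi_pos t
  unfold r; field_simp

lemma incr {s a : ℝ} (ha : 0 < a) : ∃ h, 0 < h ∧ h < a ∧
    stdNormalCDF (-s + a) - stdNormalCDF (-s) = a * phi (-s + h) := by
  obtain ⟨c, hc, h⟩ := exists_hasDerivAt_eq_slope stdNormalCDF phi (show -s < -s + a by linarith)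
    Phi_cont.continuousOn (fun t _ => Phi_deriv t)
  refine ⟨c + s, by linarith [hc.1], by linarith [hc.2], ?_⟩
  rw [show -s + (c + s) = c by ring, h, show -s + a - -s = a by ring]
  field_simp

lemma incr_lower {s a : ℝ} (ha : 0 ≤ a) (has : a ≤ 2 * s) :
    stdNormalCDF (-s) + a * phi s ≤ stdNormalCDF (-s + a) := by
  rcases ha.eq_or_lt with rfl | ha
  · simp
  obtain ⟨h, h0, h1, e⟩ := incr (s := s) ha
  have : phi s ≤ phi (-s + h) := by
    unfold phi
    gcongr ?_ / _
    apply Real.exp_le_exp.2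
    nlinarith
  nlinarith

lemma incr_upper {s a : ℝ} (hs : 0 ≤ s) (ha : 0 ≤ a) :
    stdNormalCDF (-s + a) ≤ stdNormalCDF (-s) + a * (phi s * Real.exp (s * a)) := by
  rcases ha.eq_or_lt with rfl | ha
  · simp
  obtain ⟨h, h0, h1, e⟩ := incr (s := s) ha
  have : phi (-s + h) ≤ phi s * Real.exp (s * a) := by
    unfold phi
    rw [div_mul_eq_mul_div, ← Real.exp_add]
    gcongr ?_ / _
    apply Real.exp_le_exp.2
    nlinarith
  nlinarith

/-- the boundary-layer quantile displacement -/
noncomputable def A (s β : ℝ) : ℝ :=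
  stdNormalCDFInv (stdNormalCDF (-s) * (1 + β / s ^ 2)) + s

/-- The condition that s is large enough. -/
def Good (B s : ℝ) : Prop :=
  1 ≤ s ∧ B ≤ s ∧ r s ≤ 2 ∧ stdNormalCDF (-s) * (1 + B) < 1 / 2

lemma good_ev (B : ℝ) : ∀ᶠ s in atTop, Good B s := by
  have h : Tendsto (fun s => stdNormalCDF (-s) * (1 + B)) atTop (𝓝 0) := by
    simpa using Phi_bot.mul_const (1 + B)
  filter_upwards [eventually_ge_atTop 1, eventually_ge_atTop B,
    r_tendsto.eventually (ge_mem_nhds (show (1:ℝ) < 2 by norm_num)),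
    h.eventually (gt_mem_nhds (show (0:ℝ) < 1/2 by norm_num))] with s h1 h2 h3 h4
  exact ⟨h1, h2, h3, h4⟩

lemma v_bounds {B s β : ℝ} (hg : Good B s) (h0 : 0 ≤ β) (h1 : β ≤ B) :
    stdNormalCDF (-s) ≤ stdNormalCDF (-s) * (1 + β / s ^ 2) ∧
    stdNormalCDF (-s) * (1 + β / s ^ 2) ≤ stdNormalCDF (-s) * (1 + B) := by
  obtain ⟨hs, -, -, -⟩ := hg
  have hp := Phi_pos (-s)
  have e0 : 0 ≤ β / s ^ 2 := by positivity
  have e1 : β / s ^ 2 ≤ B := by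
    rw [div_le_iff₀ (by positivity)]
    have : 1 ≤ s ^ 2 := by nlinarith
    nlinarith
  constructor <;> nlinarith

lemma A_spec {B s β : ℝ} (hg : Good B s) (h0 : 0 ≤ β) (h1 : β ≤ B) :
    0 ≤ A s β ∧ s ^ 3 * A s β ≤ r s * β ∧
    r s * β ≤ s ^ 3 * A s β * Real.exp (2 * B / s ^ 2) := by
  obtain ⟨hv0, hv1⟩ := v_bounds hg h0 h1
  obtain ⟨hs, hB, hr, hh⟩ := hg
  have hp := Phi_pos (-s)
  have hs0 : 0 < s := by linarith
  have hph := phi_pos s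
  have hr0 : 0 < r s := by unfold r; positivity
  have hA : stdNormalCDF (-s + A s β) = stdNormalCDF (-s) * (1 + β / s ^ 2) := by
    unfold A
    rw [show -s + (stdNormalCDFInv (stdNormalCDF (-s) * (1 + β / s ^ 2)) + s)
      = stdNormalCDFInv (stdNormalCDF (-s) * (1 + β / s ^ 2)) by ring]
    exact Phi_inv (by linarith) (by linarith)
  have hA0 : 0 ≤ A s β := by
    have : -s ≤ -s + A s β := by
      rw [← Phi_mono.le_iff_le, hA]; exact hv0
    linarith
  have hval : stdNormalCDF (-s) * (1 + β / s ^ 2) = stdNormalCDF (-s) + r s * β / s ^ 3 * phi s := by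
    have := Phi_eq_r hs0
    rw [mul_add, mul_one]
    congr 1
    rw [this]
    field_simp
  have hA1 : A s β ≤ r s * β / s ^ 3 := by
    have hle : r s * β / s ^ 3 ≤ 2 * s := by
      rw [div_le_iff₀ (by positivity)]
      have : 1 ≤ s ^ 3 := one_le_pow₀ hs
      have : r s * β ≤ 2 * s := by nlinarith
      nlinarith
    have := incr_lower (s := s) (a := r s * β / s ^ 3) (by positivity) hle
    rw [← hval, ← hA, Phi_mono.le_iff_le] at this
    linarith
  have hA1' : s ^ 3 * A s β ≤ r s * β := by
    rw [le_div_iff₀ (by positivity)] at hA1; linarith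
  refine ⟨hA0, hA1', ?_⟩
  have hu := incr_upper hs0.le hA0
  rw [hA, hval] at hu
  have hu2 : r s * β / s ^ 3 ≤ A s β * Real.exp (s * A s β) := by
    have : r s * β / s ^ 3 * phi s ≤ (A s β * Real.exp (s * A s β)) * phi s := by linarith
    exact le_of_mul_le_mul_right this hph
  have hsa : s * A s β ≤ 2 * B / s ^ 2 := by
    rw [le_div_iff₀ (by positivity)]
    have : r s * β ≤ 2 * B := by nlinarith
    nlinarith
  have := Real.exp_le_exp.2 hsa
  rw [div_le_iff₀ (by positivity)] at hu2
  calc r s * β ≤ A s β * Real.exp (s * A s β) * s ^ 3 := hu2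
    _ ≤ A s β * Real.exp (2 * B / s ^ 2) * s ^ 3 := by gcongr
    _ = _ := by ring

/-- the filter: s to infinity uniformly in β -/
def L (B : ℝ) : Filter (ℝ × ℝ) := atTop ×ˢ 𝓟 (Set.Icc 0 B)

instance (B : ℝ) : (L B).IsCountablyGenerated := by unfold L; infer_instance

lemma L_fst {B : ℝ} {X : Type*} {f : ℝ → X} {l : Filter X} (h : Tendsto f atTop l) :
    Tendsto (fun q : ℝ × ℝ => f q.1) (L B) l :=
  h.comp tendsto_fst

lemma L_ev {B : ℝ} {P : ℝ → Prop} (h : ∀ᶠ s in atTop, P s) :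
    ∀ᶠ q in L B, P q.1 ∧ q.2 ∈ Set.Icc 0 B := by
  have h1 : ∀ᶠ q in L B, P q.1 := tendsto_fst.eventually h
  have h2 : ∀ᶠ q in L B, q.2 ∈ Set.Icc 0 B :=
    (tendsto_snd (f := atTop (α := ℝ)) (g := 𝓟 (Set.Icc 0 B))).eventually
      (eventually_principal.2 fun _ h => h)
  exact h1.and h2

lemma tends0 (c : ℝ) (k : ℕ) (hk : k ≠ 0) : Tendsto (fun s : ℝ => c / s ^ k) atTop (𝓝 0) :=
  tendsto_const_nhds.div_atTop (tendsto_pow_atTop hk)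

lemma A_lim (B : ℝ) :
    Tendsto (fun q : ℝ × ℝ => q.1 ^ 3 * A q.1 q.2 - q.2) (L B) (𝓝 0) := by
  have e1 : Tendsto (fun s => B * (|r s - 1| + |r s * Real.exp (-(2 * B / s ^ 2)) - 1|))
      atTop (𝓝 0) := by
    have h1 : Tendsto (fun s => |r s - 1|) atTop (𝓝 0) := by
      simpa using (r_tendsto.sub_const 1).abs
    have h2 : Tendsto (fun s => |r s * Real.exp (-(2 * B / s ^ 2)) - 1|) atTop (𝓝 0) := by
      have := (tends0 (2 * B) 2 (by norm_num)).neg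
      have := (Real.continuous_exp.tendsto _).comp this
      simpa using ((r_tendsto.mul this).sub_const 1).abs
    simpa using (h1.add h2).const_mul B
  apply squeeze_zero_norm' _ (L_fst e1)
  filter_upwards [L_ev (good_ev B)] with q ⟨hg, h0, h1⟩
  obtain ⟨-, a1, a2⟩ := A_spec hg h0 h1
  set s := q.1
  set β := q.2
  have a3 : r s * β * Real.exp (-(2 * B / s ^ 2)) ≤ s ^ 3 * A s β := by
    rw [Real.exp_neg, ← div_eq_mul_inv, div_le_iff₀ (Real.exp_pos _)]
    exact a2
  rw [Real.norm_eq_abs, abs_le]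
  set x := r s * Real.exp (-(2 * B / s ^ 2)) - 1 with hx
  have b1 : β * |r s - 1| ≤ B * |r s - 1| := by gcongr
  have b2 : β * |x| ≤ B * |x| := by gcongr
  have c1 : 0 ≤ β * |r s - 1| := by positivity
  have c2 : 0 ≤ β * |x| := by positivity
  have d1 : β * (r s - 1) ≤ β * |r s - 1| := by gcongr; exact le_abs_self _
  have d2 : β * (-|x|) ≤ β * x := by gcongr; exact neg_abs_le _
  constructor
  · have : β * x = r s * β * Real.exp (-(2 * B / s ^ 2)) - β := by rw [hx]; ring
    linarith
  · linarith

lemma sqrt_sub_le (X Y : ℝ) : |Real.sqrt X - Real.sqrt Y| ≤ Real.sqrt |X - Y| := by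
  have key : ∀ X Y : ℝ, Real.sqrt X ≤ Real.sqrt Y + Real.sqrt |X - Y| := by
    intro X Y
    rw [Real.sqrt_le_left (by positivity)]
    have h1 : Real.sqrt |X - Y| ^ 2 = |X - Y| := Real.sq_sqrt (abs_nonneg _)
    have h2 : Y ≤ Real.sqrt Y ^ 2 := by
      rcases le_total 0 Y with h | h
      · rw [Real.sq_sqrt h]
      · nlinarith [sq_nonneg (Real.sqrt Y)]
    have := le_abs_self (X - Y)
    nlinarith [mul_nonneg (Real.sqrt_nonneg Y) (Real.sqrt_nonneg |X - Y|)]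
  rw [abs_le]
  have h1 := key X Y
  have h2 := key Y X
  rw [abs_sub_comm] at h2
  constructor <;> linarith

lemma bdd_mul {B C : ℝ} {f g : ℝ × ℝ → ℝ} (hf : Tendsto f (L B) (𝓝 0))
    (hg : ∀ᶠ q in L B, |g q| ≤ C) : Tendsto (fun q => g q * f q) (L B) (𝓝 0) := by
  have h : Tendsto (fun q => C * |f q|) (L B) (𝓝 0) := by simpa using hf.abs.const_mul C
  apply squeeze_zero_norm' _ h
  filter_upwards [hg] with q hq
  rw [Real.norm_eq_abs, abs_mul]
  gcongr

lemma beta_bdd (B : ℝ) : ∀ᶠ q in L B, |q.2| ≤ B := by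
  filter_upwards [L_ev (good_ev B)] with q ⟨_, h0, h1⟩
  rwa [abs_of_nonneg h0]

lemma sqrt_beta_bdd (B : ℝ) : ∀ᶠ q in L B, |Real.sqrt q.2| ≤ Real.sqrt B := by
  filter_upwards [L_ev (good_ev B)] with q ⟨_, h0, h1⟩
  rw [abs_of_nonneg (Real.sqrt_nonneg _)]
  exact Real.sqrt_le_sqrt h1

lemma inv_L (B : ℝ) : Tendsto (fun q : ℝ × ℝ => q.1⁻¹) (L B) (𝓝 0) :=
  L_fst tendsto_inv_atTop_zero

lemma sb_lim (B z : ℝ) :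
    Tendsto (fun q : ℝ × ℝ => q.1 * Real.sqrt (A q.1 q.2 * (z + q.1)) - Real.sqrt q.2)
      (L B) (𝓝 0) := by
  have hA := A_lim B
  have h1 : Tendsto (fun q : ℝ × ℝ => (q.1 ^ 3 * A q.1 q.2 - q.2)
      + (z * ((q.1 ^ 3 * A q.1 q.2 - q.2) * q.1⁻¹) + z * (q.2 * q.1⁻¹))) (L B) (𝓝 0) := by
    simpa using hA.add (((hA.mul (inv_L B)).const_mul z).add
      ((bdd_mul (inv_L B) (beta_bdd B)).const_mul z))
  have h2 : Tendsto (fun q : ℝ × ℝ => Real.sqrt |(q.1 ^ 3 * A q.1 q.2 - q.2)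
      + (z * ((q.1 ^ 3 * A q.1 q.2 - q.2) * q.1⁻¹) + z * (q.2 * q.1⁻¹))|) (L B) (𝓝 0) := by
    simpa using h1.abs.sqrt
  apply squeeze_zero_norm' _ h2
  filter_upwards [L_ev (good_ev B)] with q ⟨hg, h0, h1⟩
  have hs : 0 < q.1 := by linarith [hg.1]
  have : q.1 * Real.sqrt (A q.1 q.2 * (z + q.1)) =
      Real.sqrt (q.1 ^ 2 * (A q.1 q.2 * (z + q.1))) := by
    rw [Real.sqrt_mul (sq_nonneg q.1), Real.sqrt_sq hs.le]
  rw [this, Real.norm_eq_abs]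
  refine (sqrt_sub_le _ _).trans_eq ?_
  congr 2
  field_simp
  ring

lemma ratio_formula {s b : ℝ} (hs : 0 < s) (hb : 0 ≤ b) :
    stdNormalCDF (-(Real.sqrt 2 * (s + b))) / (s * stdNormalCDF (-s) ^ 2) =
    Real.sqrt Real.pi * (Real.exp (-2 * (s * b)) * (Real.exp (-b ^ 2) * (1 / (1 + b * s⁻¹)) *
      (r (Real.sqrt 2 * (s + b)) / r s ^ 2))) := by
  have hr0 : 0 < r s := by
    have := Phi_pos (-s)
    have := phi_pos s
    unfold r; positivity
  rw [Phi_eq_r (t := Real.sqrt 2 * (s + b)) (by positivity), Phi_eq_r hs]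
  have h2 : Real.sqrt 2 ^ 2 = 2 := Real.sq_sqrt (by norm_num)
  have hpi : Real.sqrt Real.pi ^ 2 = Real.pi := Real.sq_sqrt Real.pi_pos.le
  have e1 : phi (Real.sqrt 2 * (s + b)) = Real.exp (-s ^ 2 / 2) ^ 2 * Real.exp (-2 * (s * b)) *
      Real.exp (-b ^ 2) / (Real.sqrt 2 * Real.sqrt Real.pi) := by
    unfold phi
    rw [Real.sqrt_mul (by norm_num), ← Real.exp_nat_mul, ← Real.exp_add, ← Real.exp_add, mul_pow, h2]
    congr 2
    push_cast; ring
  have e2 : phi s = Real.exp (-s ^ 2 / 2) / (Real.sqrt 2 * Real.sqrt Real.pi) := by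
    unfold phi
    rw [Real.sqrt_mul (by norm_num)]
  rw [e1, e2]
  have hp : 0 < Real.sqrt Real.pi := Real.sqrt_pos.2 Real.pi_pos
  have hq : 0 < Real.sqrt 2 := by positivity
  have hE := Real.exp_pos (-s ^ 2 / 2)
  generalize Real.exp (-s ^ 2 / 2) = E at *
  generalize Real.exp (-2 * (s * b)) = E1 at *
  generalize Real.exp (-b ^ 2) = E2 at *
  generalize r (Real.sqrt 2 * (s + b)) = R at *
  have hsb : 1 + b * s⁻¹ = (s + b) / s := by field_simp
  have hsb0 : 0 < s + b := by linarith
  rw [hsb]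
  field_simp

lemma base_lim : Tendsto (fun s => stdNormalCDF (-(Real.sqrt 2 * s)) / (s * stdNormalCDF (-s) ^ 2))
    atTop (𝓝 (Real.sqrt Real.pi)) := by
  have h1 : Tendsto (fun s => r (Real.sqrt 2 * s)) atTop (𝓝 1) :=
    r_tendsto.comp (tendsto_id.const_mul_atTop (by positivity))
  have h2 := (h1.div (r_tendsto.pow 2) (by norm_num)).const_mul (Real.sqrt Real.pi)
  rw [one_pow, div_one, mul_one] at h2
  refine h2.congr' ?_
  filter_upwards [eventually_gt_atTop 0] with s hs
  have := ratio_formula hs le_rfl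
  rw [add_zero] at this
  rw [this]
  simp

/-- target -/
noncomputable def T (β : ℝ) : ℝ := Real.sqrt Real.pi * Real.exp (-2 * Real.sqrt β)

lemma T_nonneg (β : ℝ) : 0 ≤ T β := by unfold T; positivity

lemma T_le (β : ℝ) : T β ≤ Real.sqrt Real.pi := by
  unfold T
  have : Real.exp (-2 * Real.sqrt β) ≤ 1 :=
    Real.exp_le_one_iff.2 (by linarith [Real.sqrt_nonneg β])
  nlinarith [Real.sqrt_nonneg Real.pi]

lemma T_bdd (B : ℝ) : ∀ᶠ q in L B, |T q.2| ≤ Real.sqrt Real.pi :=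
  Eventually.of_forall fun q => by rw [abs_of_nonneg (T_nonneg _)]; exact T_le _

lemma point_lim (B z : ℝ) :
    Tendsto (fun q : ℝ × ℝ =>
      stdNormalCDF (-(Real.sqrt 2 * (q.1 + Real.sqrt (A q.1 q.2 * (z + q.1)))))
        / (q.1 * stdNormalCDF (-q.1) ^ 2) - T q.2) (L B) (𝓝 0) := by
  have hsb := sb_lim B z
  set b : ℝ × ℝ → ℝ := fun q => Real.sqrt (A q.1 q.2 * (z + q.1)) with hbdef
  have hb : Tendsto b (L B) (𝓝 0) := by
    have h := (hsb.mul (inv_L B)).add (bdd_mul (inv_L B) (sqrt_beta_bdd B))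
    rw [mul_zero, add_zero] at h
    refine h.congr' ?_
    filter_upwards [L_ev (good_ev B)] with q ⟨hg, h0, h1⟩
    have hs : 0 < q.1 := by linarith [hg.1]
    simp only [hbdef]
    field_simp
    ring
  have hs : Tendsto (fun q : ℝ × ℝ => q.1) (L B) atTop := tendsto_fst
  have hrr : Tendsto (fun q => r (Real.sqrt 2 * (q.1 + b q))) (L B) (𝓝 1) :=
    r_tendsto.comp ((hs.atTop_add hb).const_mul_atTop (by positivity))
  have k1 : Tendsto (fun q => Real.exp (-2 * (q.1 * b q - Real.sqrt q.2))) (L B) (𝓝 1) := by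
    simpa using (hsb.const_mul (-2)).rexp
  have k2 : Tendsto (fun q => Real.exp (-(b q) ^ 2)) (L B) (𝓝 1) := by
    simpa using (hb.pow 2).neg.rexp
  have k3 : Tendsto (fun q => 1 / (1 + b q * q.1⁻¹)) (L B) (𝓝 1) := by
    have h := (hb.mul (inv_L B)).const_add 1
    rw [mul_zero, add_zero] at h
    simpa using h.inv₀ (by norm_num)
  have k4 : Tendsto (fun q => r (Real.sqrt 2 * (q.1 + b q)) / r q.1 ^ 2) (L B) (𝓝 1) := by
    have h := hrr.div ((L_fst (B := B) r_tendsto).pow 2) (by norm_num)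
    rw [one_pow, div_one] at h
    exact h
  have k : Tendsto (fun q => Real.exp (-2 * (q.1 * b q - Real.sqrt q.2)) *
      (Real.exp (-(b q) ^ 2) * (1 / (1 + b q * q.1⁻¹)) *
        (r (Real.sqrt 2 * (q.1 + b q)) / r q.1 ^ 2)) - 1) (L B) (𝓝 0) := by
    have := (k1.mul ((k2.mul k3).mul k4)).sub_const 1
    simpa only [mul_one, sub_self] using this
  refine (bdd_mul k (T_bdd B)).congr' ?_
  filter_upwards [L_ev (good_ev B)] with q ⟨hg, h0, h1⟩
  have hs : 0 < q.1 := by linarith [hg.1]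
  rw [ratio_formula hs (Real.sqrt_nonneg _)]
  change _ = Real.sqrt Real.pi * (Real.exp (-2 * (q.1 * b q)) * (Real.exp (-(b q) ^ 2) *
    (1 / (1 + b q * q.1⁻¹)) * (r (Real.sqrt 2 * (q.1 + b q)) / r q.1 ^ 2))) - T q.2
  have : Real.exp (-2 * (q.1 * b q)) =
      Real.exp (-2 * Real.sqrt q.2) * Real.exp (-2 * (q.1 * b q - Real.sqrt q.2)) := by
    rw [← Real.exp_add]; congr 1; ring
  rw [this]
  unfold T
  ring

lemma pPair_eq (s β w : ℝ) :
    pPair (stdNormalCDF (-s)) (stdNormalCDF (-s) * (1 + β / s ^ 2)) w =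
    stdNormalCDF (-(Real.sqrt 2 * (s + Real.sqrt (A s β * (stdNormalCDFInv w + s))))) := by
  unfold pPair A
  rw [inv_Phi]
  congr 1
  simp only [sub_neg_eq_add]
  ring

lemma pPair_le (s β w : ℝ) :
    pPair (stdNormalCDF (-s)) (stdNormalCDF (-s) * (1 + β / s ^ 2)) w ≤
    stdNormalCDF (-(Real.sqrt 2 * s)) := by
  rw [pPair_eq, Phi_mono.le_iff_le]
  have : 0 ≤ Real.sqrt 2 * Real.sqrt (A s β * (stdNormalCDFInv w + s)) := by positivity
  linarith

lemma inv_mono : MonotoneOn stdNormalCDFInv (Set.Ioo 0 1) := by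
  intro a ha b hb hab
  rw [← Phi_mono.le_iff_le, Phi_inv ha.1 ha.2, Phi_inv hb.1 hb.2]
  exact hab

lemma pPair_int {s β : ℝ} (hA : 0 ≤ A s β) :
    IntegrableOn (pPair (stdNormalCDF (-s)) (stdNormalCDF (-s) * (1 + β / s ^ 2)))
      (Set.Ioo 0 1) := by
  have hanti : AntitoneOn (pPair (stdNormalCDF (-s)) (stdNormalCDF (-s) * (1 + β / s ^ 2)))
      (Set.Ioo 0 1) := by
    intro a ha b hb hab
    rw [pPair_eq, pPair_eq, Phi_mono.le_iff_le]
    have := inv_mono ha hb hab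
    gcongr
  refine Integrable.of_bound
    (aemeasurable_restrict_of_antitoneOn measurableSet_Ioo hanti).aestronglyMeasurable 1 ?_
  refine Eventually.of_forall fun w => ?_
  rw [pPair_eq, Real.norm_eq_abs, abs_of_pos (Phi_pos _)]
  exact (Phi_lt_one _).le

/-- lower limit of integration -/
noncomputable def V (q : ℝ × ℝ) : ℝ := stdNormalCDF (-q.1) * (1 + q.2 / q.1 ^ 2)

lemma V_lim (B : ℝ) : Tendsto V (L B) (𝓝 0) := by
  have h : Tendsto (fun s => stdNormalCDF (-s) * (1 + B)) atTop (𝓝 0) := by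
    simpa using Phi_bot.mul_const (1 + B)
  refine tendsto_of_tendsto_of_tendsto_of_le_of_le' tendsto_const_nhds (L_fst h) ?_ ?_
  · filter_upwards [L_ev (good_ev B)] with q ⟨hg, h0, h1⟩
    exact (Phi_pos _).le.trans (v_bounds hg h0 h1).1
  · filter_upwards [L_ev (good_ev B)] with q ⟨hg, h0, h1⟩
    exact (v_bounds hg h0 h1).2

/-- scaled integrand on the unit interval -/
noncomputable def F (q : ℝ × ℝ) (w : ℝ) : ℝ :=
  (Set.Ioo (V q) 1).indicator (pPair (stdNormalCDF (-q.1)) (V q)) w *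
    (1 / (q.1 * stdNormalCDF (-q.1) ^ 2) * (1 / (1 - V q)))

lemma F_int {B : ℝ} {q : ℝ × ℝ} (hg : Good B q.1) (h : q.2 ∈ Set.Icc 0 B) :
    IntegrableOn (F q) (Set.Ioo 0 1) := by
  have h1 := pPair_int (A_spec hg h.1 h.2).1
  exact (Integrable.indicator h1 measurableSet_Ioo).mul_const _

lemma F_integral {B : ℝ} {q : ℝ × ℝ} (hg : Good B q.1) (h : q.2 ∈ Set.Icc 0 B) :
    ∫ w in Set.Ioo 0 1, (F q w - T q.2) =
      Gavg (stdNormalCDF (-q.1)) (V q) / (q.1 * stdNormalCDF (-q.1) ^ 2) - T q.2 := by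
  have hv : 0 ≤ V q := (Phi_pos _).le.trans (v_bounds hg h.1 h.2).1
  rw [integral_sub (F_int hg h) (integrable_const _)]
  congr 1
  · unfold F
    rw [integral_mul_const, setIntegral_indicator measurableSet_Ioo]
    have : Set.Ioo (0:ℝ) 1 ∩ Set.Ioo (V q) 1 = Set.Ioo (V q) 1 :=
      Set.inter_eq_right.2 (Set.Ioo_subset_Ioo_left hv)
    rw [this]
    unfold Gavg
    ring
  · simp

lemma F_lim (B : ℝ) : Tendsto (fun q : ℝ × ℝ =>
    Gavg (stdNormalCDF (-q.1)) (V q) / (q.1 * stdNormalCDF (-q.1) ^ 2) - T q.2) (L B) (𝓝 0) := by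
  have main : Tendsto (fun q : ℝ × ℝ => ∫ w in Set.Ioo 0 1, (F q w - T q.2)) (L B)
      (𝓝 (∫ w in Set.Ioo (0:ℝ) 1, (0:ℝ))) := by
    apply tendsto_integral_filter_of_dominated_convergence
      (fun _ => (Real.sqrt Real.pi + 1) * 2 + Real.sqrt Real.pi)
    · filter_upwards [L_ev (good_ev B)] with q ⟨hg, h⟩
      exact ((F_int hg h).sub (integrable_const _)).aestronglyMeasurable
    · have hbase := base_lim.eventually (ge_mem_nhds (lt_add_one (Real.sqrt Real.pi)))
      filter_upwards [L_ev ((good_ev B).and hbase)] with q ⟨⟨hg, hb⟩, h⟩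
      refine Eventually.of_forall fun w => ?_
      have hv : V q ≤ 1 / 2 := (v_bounds hg h.1 h.2).2.trans hg.2.2.2.le
      have hs : 0 < q.1 := by linarith [hg.1]
      have hP := Phi_pos (-q.1)
      refine (norm_sub_le _ _).trans (add_le_add ?_ ?_)
      · have hi0 : 0 ≤ (Set.Ioo (V q) 1).indicator (pPair (stdNormalCDF (-q.1)) (V q)) w := by
          apply Set.indicator_nonneg
          intro w _
          exact (Phi_pos _).le
        have hi : (Set.Ioo (V q) 1).indicator (pPair (stdNormalCDF (-q.1)) (V q)) w ≤
            stdNormalCDF (-(Real.sqrt 2 * q.1)) := by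
          apply Set.indicator_le' (g := fun _ => stdNormalCDF (-(Real.sqrt 2 * q.1)))
          · intro w _
            exact pPair_le q.1 q.2 w
          · intro w _
            exact (Phi_pos _).le
        have h2 : 1 / (1 - V q) ≤ 2 := by
          rw [div_le_iff₀ (by linarith)]; linarith
        have h20 : 0 ≤ 1 / (1 - V q) := by
          apply div_nonneg <;> linarith
        unfold F
        rw [Real.norm_eq_abs, abs_of_nonneg (by positivity), ← mul_assoc]
        apply mul_le_mul _ h2 h20 (by positivity)
        refine le_trans ?_ hb
        rw [div_eq_mul_one_div (stdNormalCDF (-(Real.sqrt 2 * q.1)))]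
        exact mul_le_mul_of_nonneg_right hi (by positivity)
      · rw [Real.norm_eq_abs, abs_of_nonneg (T_nonneg _)]
        exact T_le _
    · exact integrable_const _
    · refine (ae_restrict_iff' measurableSet_Ioo).2 (Eventually.of_forall fun w hw => ?_)
      have hp := point_lim B (stdNormalCDFInv w)
      have hV := V_lim B
      have hh : Tendsto (fun q => 1 / (1 - V q)) (L B) (𝓝 1) := by
        have := (hV.const_sub 1).inv₀ (by norm_num)
        simpa using this
      have hh1 : Tendsto (fun q => 1 / (1 - V q) - 1) (L B) (𝓝 0) := by
        simpa using hh.sub_const 1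
      have := (hp.mul hh).add (bdd_mul hh1 (T_bdd B))
      rw [zero_mul, add_zero] at this
      refine this.congr' ?_
      filter_upwards [hV.eventually (gt_mem_nhds hw.1)] with q hq
      unfold F
      rw [Set.indicator_of_mem (show w ∈ Set.Ioo (V q) 1 from ⟨hq, hw.2⟩)]
      have e := pPair_eq q.1 q.2 w
      change pPair (stdNormalCDF (-q.1)) (V q) w = _ at e
      rw [e]
      ring
  rw [integral_zero] at main
  refine main.congr' ?_
  filter_upwards [L_ev (good_ev B)] with q ⟨hg, h⟩
  exact F_integral hg h

lemma unif (B ε : ℝ) (hε : 0 < ε) : ∃ S, 0 < S ∧ ∀ s, S ≤ s → ∀ β ∈ Set.Icc 0 B,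
    |Gavg (stdNormalCDF (-s)) (stdNormalCDF (-s) * (1 + β / s ^ 2))
      / (s * stdNormalCDF (-s) ^ 2) - T β| < ε := by
  have h := Metric.tendsto_nhds.1 (F_lim B) ε hε
  unfold L at h
  rw [eventually_prod_principal_iff, eventually_atTop] at h
  obtain ⟨S, hS⟩ := h
  refine ⟨max S 1, by positivity, fun s hs β hβ => ?_⟩
  have := hS s ((le_max_left _ _).trans hs) β hβ
  simpa [Real.dist_eq, V] using this

end BL

/-- Boundary-layer limit for the averaged edge probability: uniformly for
`(x,β) ∈ [δ,M]×[0,B]`,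
`(n²/s_n(x)) G(x/n, x(1+β/s_n(x)²)/n) → √π x² e^{−2√β}`. -/
theorem averaged_edge_probability_boundary_layer (δ M B : ℝ)
    (hδ : 0 < δ) (hM : δ < M) (hB : 0 ≤ B) :
    ∀ ε : ℝ, 0 < ε → ∃ N : ℕ, ∀ n : ℕ, N ≤ n →
      ∀ x ∈ Set.Icc δ M, ∀ β ∈ Set.Icc (0 : ℝ) B,
        |((n : ℝ) ^ 2 / sQ n x) *
            Gavg (x / n) (x * (1 + β / (sQ n x) ^ 2) / n) -
          Real.sqrt Real.pi * x ^ 2 * Real.exp (-2 * Real.sqrt β)| < ε := by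
  intro ε hε
  have hM0 : 0 < M := hδ.trans hM
  obtain ⟨S, hS0, hS⟩ := BL.unif B (ε / M ^ 2) (by positivity)
  have hP := BL.Phi_pos (-S)
  obtain ⟨N, hN⟩ := exists_nat_gt (M / stdNormalCDF (-S))
  refine ⟨N, fun n hn x hx β hβ => ?_⟩
  have hx0 : 0 < x := hδ.trans_le hx.1
  have hnN : M / stdNormalCDF (-S) < n := hN.trans_le (by exact_mod_cast hn)
  have hn0 : (0:ℝ) < n := lt_trans (by positivity) hnN
  rw [div_lt_iff₀ hP] at hnN
  have hxn : x / n < stdNormalCDF (-S) := by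
    rw [div_lt_iff₀ hn0]
    linarith [hx.2]
  have hu : stdNormalCDF (-sQ n x) = x / n := by
    unfold sQ
    rw [neg_neg]
    exact BL.Phi_inv (by positivity) (hxn.trans (BL.Phi_lt_one _))
  have hsS : S ≤ sQ n x := by
    rw [← hu, BL.Phi_mono.lt_iff_lt] at hxn
    linarith
  have hs0 : 0 < sQ n x := hS0.trans_le hsS
  have key := hS _ hsS β hβ
  rw [hu] at key
  have hv : x * (1 + β / (sQ n x) ^ 2) / n = x / n * (1 + β / (sQ n x) ^ 2) := by ring
  rw [hv]
  have e : (n : ℝ) ^ 2 / sQ n x * Gavg (x / n) (x / n * (1 + β / (sQ n x) ^ 2)) -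
      Real.sqrt Real.pi * x ^ 2 * Real.exp (-2 * Real.sqrt β) =
      x ^ 2 * (Gavg (x / n) (x / n * (1 + β / (sQ n x) ^ 2)) / (sQ n x * (x / n) ^ 2) - BL.T β) := by
    unfold BL.T
    field_simp
  rw [e, abs_mul, abs_of_pos (by positivity)]
  have hxM : x ^ 2 ≤ M ^ 2 := by
    have := hx.2
    gcongr
  rw [lt_div_iff₀ (by positivity)] at key
  refine lt_of_le_of_lt ?_ key
  rw [mul_comm]
  gcongr
end
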